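/- Let G be a finite simple graph with vertex set of size n, t triangles (3-cliques), and let Δ denote the maximum, over all edges e of G, of the number of triangles of G containing e. Fix a constant γ > 0 and p ∈ (0,1]. Form the random subgraph G' by keeping each edge of G independently with probability p, and let T be the number of triangles of G'. Then for any constants K > 0 and ε > 0 there exists n₀ (depending on K, ε, γ) such that: if n ≥ n₀, p²Δ < 1, and p³·t ≥ (log n)^{6+γ}, then P(|T − E[T]| ≥ ε·E[T]) ≤ n^{−K}. -/

import Mathlib

open Finset

section Defs

variable {V : Type*} [Fintype V] [DecidableEq V]

/-- The weight of an outcome `ω` of independent coin flips, one for each coordinate,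
under the product of Bernoulli(p) measures: a kept coordinate (`ω e = true`)
contributes `p`, a discarded one contributes `1 - p`. -/
noncomputable def bernWeight {ι : Type*} [Fintype ι] (p : ℝ) (ω : ι → Bool) : ℝ :=
  ∏ e : ι, if ω e then p else 1 - p

/-- Expectation of `f` with respect to the product Bernoulli(p) measure. -/
noncomputable def bernExpect {ι : Type*} [Fintype ι] [DecidableEq ι]
    (p : ℝ) (f : (ι → Bool) → ℝ) : ℝ :=
  ∑ ω : ι → Bool, bernWeight p ω * f ω

open scoped Classical in
/-- Probability of the event `A` under the product Bernoulli(p) measure. -/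
noncomputable def bernProb {ι : Type*} [Fintype ι] [DecidableEq ι]
    (p : ℝ) (A : (ι → Bool) → Prop) : ℝ :=
  ∑ ω : ι → Bool, if A ω then bernWeight p ω else 0

/-- The triangle-counting random variable `T = Σ_{triangles {e,f,g}} X_e X_f X_g`:
the sum over all triangles (3-cliques) of `G` of the product, over the three edges
of the triangle, of the indicator that the edge is kept. -/
noncomputable def triCount (G : SimpleGraph V) [DecidableRel G.Adj]
    (ω : {e : Sym2 V // e ∈ G.edgeFinset} → Bool) : ℝ :=
  ∑ s ∈ G.cliqueFinset 3,
    ∏ e ∈ univ.filter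
        (fun e : {e : Sym2 V // e ∈ G.edgeFinset} => (e : Sym2 V) ∈ s.sym2),
      (if ω e then (1 : ℝ) else 0)

/-- `Δ(e)`: the number of triangles (3-cliques) of `G` containing the edge `e`. -/
def triEdgeCount (G : SimpleGraph V) [DecidableRel G.Adj] (e : Sym2 V) : ℕ :=
  ((G.cliqueFinset 3).filter (fun s => e ∈ s.sym2)).card

/-- `Δ = max_e Δ(e)`: the maximum, over all edges of `G`, of the number of
triangles containing that edge. -/
def maxTriEdge (G : SimpleGraph V) [DecidableRel G.Adj] : ℕ :=
  G.edgeFinset.sup (triEdgeCount G)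

end Defs

section ProductBernoulli

variable {ι : Type*} [Fintype ι] {p : ℝ}

lemma bernWeight_nonneg (hp : 0 ≤ p) (hp1 : p ≤ 1) (ω : ι → Bool) : 0 ≤ bernWeight p ω :=
  prod_nonneg fun e _ => by split_ifs <;> linarith

variable [DecidableEq ι]

lemma bernExpect_one : bernExpect p (fun _ : ι → Bool => (1 : ℝ)) = 1 := by
  have h := Fintype.prod_sum (fun (_ : ι) (b : Bool) => if b then p else 1 - p)
  simp only [Fintype.sum_bool] at h
  simp only [bernExpect, bernWeight, mul_one]
  rw [← h]
  simp

lemma bernExpect_const_mul (c : ℝ) (f : (ι → Bool) → ℝ) :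
    bernExpect p (fun ω => c * f ω) = c * bernExpect p f := by
  simp only [bernExpect, mul_sum]
  exact sum_congr rfl fun ω _ => by ring

lemma bernExpect_add (f g : (ι → Bool) → ℝ) :
    bernExpect p (fun ω => f ω + g ω) = bernExpect p f + bernExpect p g := by
  simp only [bernExpect, mul_add, sum_add_distrib]

lemma bernExpect_sub (f g : (ι → Bool) → ℝ) :
    bernExpect p (fun ω => f ω - g ω) = bernExpect p f - bernExpect p g := by
  simp only [bernExpect, mul_sub, sum_sub_distrib]

lemma bernExpect_sum {α : Type*} (A : Finset α) (f : α → (ι → Bool) → ℝ) :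
    bernExpect p (fun ω => ∑ s ∈ A, f s ω) = ∑ s ∈ A, bernExpect p (f s) := by
  simp only [bernExpect, mul_sum]
  exact sum_comm

lemma bernExpect_mono (hp : 0 ≤ p) (hp1 : p ≤ 1) {f g : (ι → Bool) → ℝ} (h : ∀ ω, f ω ≤ g ω) :
    bernExpect p f ≤ bernExpect p g :=
  sum_le_sum fun ω _ => mul_le_mul_of_nonneg_left (h ω) (bernWeight_nonneg hp hp1 ω)

lemma bernExpect_nonneg (hp : 0 ≤ p) (hp1 : p ≤ 1) {f : (ι → Bool) → ℝ} (h : ∀ ω, 0 ≤ f ω) :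
    0 ≤ bernExpect p f :=
  sum_nonneg fun ω _ => mul_nonneg (bernWeight_nonneg hp hp1 ω) (h ω)

lemma bernProb_le_bernExpect (hp : 0 ≤ p) (hp1 : p ≤ 1) {A : (ι → Bool) → Prop}
    {g : (ι → Bool) → ℝ} (hg : ∀ ω, 0 ≤ g ω) (hA : ∀ ω, A ω → 1 ≤ g ω) :
    bernProb p A ≤ bernExpect p g := by
  refine sum_le_sum fun ω _ => ?_
  have hw := bernWeight_nonneg hp hp1 ω
  split_ifs with h
  · exact le_mul_of_one_le_right hw (hA ω h)
  · exact mul_nonneg hw (hg ω)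

lemma bernExpect_indicator_mul (e : ι) (f : (ι → Bool) → ℝ) :
    bernExpect p (fun ω => (if ω e then (1 : ℝ) else 0) * f ω) =
      p * bernExpect p (fun ω => f (Function.update ω e true)) := by
  have hw : ∀ (b : Bool) (r : {j // j ≠ e} → Bool),
      bernWeight p ((Equiv.funSplitAt e Bool).symm (b, r)) =
        (if b then p else 1 - p) * ∏ j, if r j then p else 1 - p := by
    intro b r
    rw [bernWeight, Fintype.prod_eq_mul_prod_subtype_ne _ e]
    congr 1
    · simp
    · refine prod_congr rfl fun j _ => ?_
      simp [j.2]
  have hu : ∀ (b : Bool) (r : {j // j ≠ e} → Bool),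
      Function.update ((Equiv.funSplitAt e Bool).symm (b, r)) e true =
        (Equiv.funSplitAt e Bool).symm (true, r) := by
    intro b r
    ext j
    by_cases h : j = e
    · subst h; simp
    · simp [h]
  simp only [bernExpect]
  rw [← (Equiv.funSplitAt e Bool).symm.sum_comp, ← (Equiv.funSplitAt e Bool).symm.sum_comp,
    Fintype.sum_prod_type, Fintype.sum_prod_type]
  simp only [Fintype.sum_bool, hw, hu]
  simp only [Equiv.funSplitAt_symm_apply, dite_true, if_true, Bool.false_eq_true, if_false,
    zero_mul, mul_zero, sum_const_zero, add_zero, one_mul]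
  rw [← sum_add_distrib, mul_sum]
  exact sum_congr rfl fun r _ => by ring

/-- The indicator that every coordinate in `C` is kept. -/
noncomputable def kept (C : Finset ι) (ω : ι → Bool) : ℝ :=
  ∏ e ∈ C, if ω e then (1 : ℝ) else 0

/-- The outcome obtained from `ω` by keeping, in addition, every coordinate in `C`. -/
def forceOn (C : Finset ι) (ω : ι → Bool) : ι → Bool := fun e => decide (e ∈ C) || ω e

lemma kept_eq_ite (C : Finset ι) (ω : ι → Bool) :
    kept C ω = if ∀ e ∈ C, ω e then 1 else 0 := by
  rw [kept, prod_ite_zero, prod_const_one]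
  congr

lemma kept_nonneg (C : Finset ι) (ω : ι → Bool) : 0 ≤ kept C ω := by
  rw [kept_eq_ite]; split_ifs <;> norm_num

lemma kept_le_one (C : Finset ι) (ω : ι → Bool) : kept C ω ≤ 1 := by
  rw [kept_eq_ite]; split_ifs <;> norm_num

lemma kept_forceOn (C U : Finset ι) (ω : ι → Bool) :
    kept C (forceOn U ω) = kept (C \ U) ω := by
  simp only [kept_eq_ite]
  congr 1
  simp only [forceOn, mem_sdiff, Bool.or_eq_true, decide_eq_true_eq, eq_iff_iff]
  exact forall_congr' fun e => by tauto

lemma kept_mul_kept (C D : Finset ι) (ω : ι → Bool) :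
    kept C ω * kept D ω = kept (C ∪ D) ω := by
  simp only [kept_eq_ite, ite_zero_mul_ite_zero, mul_one]
  congr 1
  simp only [mem_union, eq_iff_iff]
  exact ⟨fun h e he => he.elim (h.1 e) (h.2 e), fun h => ⟨fun e he => h e (.inl he),
    fun e he => h e (.inr he)⟩⟩

lemma kept_le_kept_forceOn (C U : Finset ι) (ω : ι → Bool) :
    kept C ω ≤ kept C (forceOn U ω) := by
  rw [kept_eq_ite]
  split_ifs with h
  · rw [kept_eq_ite, if_pos fun e he => by simp [forceOn, h e he]]
  · exact kept_nonneg _ _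

lemma bernExpect_kept_mul (C : Finset ι) (f : (ι → Bool) → ℝ) :
    bernExpect p (fun ω => kept C ω * f ω) =
      p ^ #C * bernExpect p (fun ω => f (forceOn C ω)) := by
  induction C using Finset.induction_on generalizing f with
  | empty =>
    have h : ∀ ω : ι → Bool, forceOn ∅ ω = ω := fun ω => by ext; simp [forceOn]
    simp [kept, h]
  | insert e C he ih =>
    have hk : ∀ ω, kept (insert e C) ω * f ω =
        kept C ω * ((if ω e then (1 : ℝ) else 0) * f ω) := by
      intro ω
      rw [kept, prod_insert he, kept]
      ring
    simp only [hk]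
    rw [ih, card_insert_of_notMem he]
    have hfe : ∀ ω, forceOn C ω e = ω e := fun ω => by simp [forceOn, he]
    simp only [hfe]
    rw [bernExpect_indicator_mul e (fun ω => f (forceOn C ω)), pow_succ, mul_assoc]
    congr 3
    ext ω
    congr 1
    ext j
    by_cases h : j = e
    · subst h; simp [forceOn]
    · simp [forceOn, h]

lemma bernExpect_kept (C : Finset ι) : bernExpect p (kept C) = p ^ #C := by
  have h := bernExpect_kept_mul (p := p) C (fun _ => 1)
  simpa [bernExpect_one] using h

end ProductBernoulli

section LinearTriples

variable {ι α : Type*} [DecidableEq ι] {p : ℝ}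
  {A : Finset α} {E : α → Finset ι}

lemma pow_card_sdiff_le (hp : 0 ≤ p) (hp1 : p ≤ 1) {S : Finset ι} (hS : #S = 3)
    (U : Finset ι) :
    p ^ #(S \ U) ≤ p ^ 3 + (∑ e ∈ U, if e ∈ S then p ^ 2 else 0) +
      ∑ x ∈ U.offDiag, if x.1 ∈ S ∧ x.2 ∈ S then (1 : ℝ) else 0 := by
  have h1 : (∑ e ∈ U, if e ∈ S then p ^ 2 else 0) = #(S ∩ U) * p ^ 2 := by
    rw [← sum_filter, sum_const, nsmul_eq_mul, filter_mem_eq_inter, inter_comm]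
  have h2 : (∑ x ∈ U.offDiag, if x.1 ∈ S ∧ x.2 ∈ S then (1 : ℝ) else 0) =
      #(S ∩ U).offDiag := by
    rw [← sum_filter, sum_const, nsmul_eq_mul, mul_one]
    congr 2
    ext x
    simp only [mem_filter, mem_offDiag, mem_inter]
    tauto
  have h3 : #(S \ U) + #(S ∩ U) = 3 := by rw [card_sdiff_add_card_inter, hS]
  rw [h1, h2, offDiag_card]
  obtain h | h | h : #(S ∩ U) = 0 ∨ #(S ∩ U) = 1 ∨ 2 ≤ #(S ∩ U) := by omega
  · rw [h, show #(S \ U) = 3 by omega]; simp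
  · rw [h, show #(S \ U) = 2 by omega]
    have := pow_nonneg hp 3
    norm_num
    linarith
  · have h4 : 1 ≤ #(S ∩ U) * #(S ∩ U) - #(S ∩ U) := by
      have : 2 * #(S ∩ U) ≤ #(S ∩ U) * #(S ∩ U) := Nat.mul_le_mul_right _ h
      omega
    have h5 : (1 : ℝ) ≤ ((#(S ∩ U) * #(S ∩ U) - #(S ∩ U) : ℕ) : ℝ) := by exact_mod_cast h4
    have h6 : p ^ #(S \ U) ≤ 1 := pow_le_one₀ hp hp1
    have h7 : 0 ≤ p ^ 3 + #(S ∩ U) * p ^ 2 := by positivity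
    linarith

/-- In a linear family of triples in which every point has degree at most `p⁻²`, the expected
number of triples surviving once the points of `U` are kept exceeds the unconditional
expectation by at most `#U + #U²`. -/
lemma sum_pow_card_sdiff_le (hp : 0 ≤ p) (hp1 : p ≤ 1) (hcard : ∀ s ∈ A, #(E s) = 3)
    (hpair : ∀ s ∈ A, ∀ s' ∈ A, s ≠ s' → #(E s ∩ E s') ≤ 1)
    (hdeg : ∀ e, p ^ 2 * #{s ∈ A | e ∈ E s} ≤ 1) (U : Finset ι) :
    ∑ s ∈ A, p ^ #(E s \ U) ≤ p ^ 3 * #A + #U + (#U : ℝ) ^ 2 := by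
  calc ∑ s ∈ A, p ^ #(E s \ U)
      ≤ ∑ s ∈ A, (p ^ 3 + (∑ e ∈ U, if e ∈ E s then p ^ 2 else 0) +
        ∑ x ∈ U.offDiag, if x.1 ∈ E s ∧ x.2 ∈ E s then (1 : ℝ) else 0) :=
        sum_le_sum fun s hs => pow_card_sdiff_le hp hp1 (hcard s hs) U
    _ = p ^ 3 * #A + (∑ e ∈ U, p ^ 2 * #{s ∈ A | e ∈ E s}) +
        ∑ x ∈ U.offDiag, (#{s ∈ A | x.1 ∈ E s ∧ x.2 ∈ E s} : ℝ) := by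
        rw [sum_add_distrib, sum_add_distrib, sum_const, nsmul_eq_mul, mul_comm,
          sum_comm (s := A) (t := U), sum_comm (s := A) (t := U.offDiag)]
        congr 1
        · congr 1
          refine sum_congr rfl fun e _ => ?_
          rw [← sum_filter, sum_const, nsmul_eq_mul, mul_comm]
        · refine sum_congr rfl fun x _ => ?_
          rw [← sum_filter, sum_const, nsmul_eq_mul, mul_one]
    _ ≤ p ^ 3 * #A + (∑ e ∈ U, (1 : ℝ)) + ∑ x ∈ U.offDiag, (1 : ℝ) := by
        gcongr with e _ x hx
        · exact hdeg e
        · norm_cast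
          refine card_le_one.2 fun s hs s' hs' => ?_
          simp only [mem_filter] at hs hs'
          by_contra hne
          exact (mem_offDiag.1 hx).2.2 (card_le_one.1 (hpair s hs.1 s' hs'.1 hne) _
            (mem_inter.2 ⟨hs.2.1, hs'.2.1⟩) _ (mem_inter.2 ⟨hs.2.2, hs'.2.2⟩))
    _ ≤ p ^ 3 * #A + #U + (#U : ℝ) ^ 2 := by
        simp only [sum_const, nsmul_eq_mul, mul_one]
        gcongr
        rw [offDiag_card, sq]
        exact_mod_cast Nat.sub_le _ _

variable [Fintype ι]

lemma bernExpect_pow_sum_kept_le (hp : 0 ≤ p) (hp1 : p ≤ 1) (hcard : ∀ s ∈ A, #(E s) = 3)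
    (hpair : ∀ s ∈ A, ∀ s' ∈ A, s ≠ s' → #(E s ∩ E s') ≤ 1)
    (hdeg : ∀ e, p ^ 2 * #{s ∈ A | e ∈ E s} ≤ 1) (m k : ℕ) (U : Finset ι)
    (hU : #U + 3 * k ≤ m) :
    bernExpect p (fun ω => (∑ s ∈ A, kept (E s) (forceOn U ω)) ^ k) ≤
      (p ^ 3 * #A + m + (m : ℝ) ^ 2) ^ k := by
  induction k generalizing U with
  | zero => simp [bernExpect_one]
  | succ k ih =>
    have hforce : ∀ s ω, forceOn U (forceOn (E s \ U) ω) = forceOn (U ∪ E s) ω := by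
      intro s ω
      ext e
      simp only [forceOn, mem_sdiff, mem_union]
      by_cases h1 : e ∈ U <;> by_cases h2 : e ∈ E s <;> simp [h1, h2]
    have hstep : ∀ s ∈ A,
        bernExpect p (fun ω => kept (E s) (forceOn U ω) *
          (∑ s ∈ A, kept (E s) (forceOn U ω)) ^ k) ≤
        p ^ #(E s \ U) * (p ^ 3 * #A + m + (m : ℝ) ^ 2) ^ k := by
      intro s hs
      simp only [kept_forceOn (E s) U]
      rw [bernExpect_kept_mul (E s \ U) (fun ω => (∑ s ∈ A, kept (E s) (forceOn U ω)) ^ k)]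
      refine mul_le_mul_of_nonneg_left ?_ (by positivity)
      simp only [hforce]
      refine ih _ ?_
      have := card_union_le U (E s)
      have := hcard s hs
      omega
    have hUm : (#U : ℝ) ≤ m := by exact_mod_cast (by omega : #U ≤ m)
    have hsum : ∑ s ∈ A, p ^ #(E s \ U) ≤ p ^ 3 * #A + m + (m : ℝ) ^ 2 :=
      (sum_pow_card_sdiff_le hp hp1 hcard hpair hdeg U).trans (by gcongr)
    simp only [pow_succ' _ k, sum_mul]
    rw [bernExpect_sum]
    refine (sum_le_sum hstep).trans ?_
    rw [← sum_mul]
    gcongr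

lemma bernExpect_sum_kept (hcard : ∀ s ∈ A, #(E s) = 3) :
    bernExpect p (fun ω => ∑ s ∈ A, kept (E s) ω) = p ^ 3 * #A := by
  rw [bernExpect_sum, sum_congr rfl fun s hs => (bernExpect_kept (E s)).trans
    (by rw [hcard s hs]), sum_const, nsmul_eq_mul, mul_comm]

lemma exp_neg_mul_sum_kept_le {a : ℝ} (ha3 : a ≤ 1 / 3) (ω : ι → Bool) :
    Real.exp (-((a + 2 * a ^ 2) * ∑ s ∈ A, kept (E s) ω)) ≤
      ∏ s ∈ A, (1 - a * kept (E s) ω) := by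
  rw [mul_sum, ← sum_neg_distrib, Real.exp_sum]
  refine prod_le_prod (fun _ _ => (Real.exp_pos _).le) fun s _ => ?_
  rw [kept_eq_ite]
  split_ifs
  · have h1 := Real.add_one_le_exp (a + 2 * a ^ 2)
    have h2 : 1 ≤ (1 - a) * (a + 2 * a ^ 2 + 1) := by nlinarith [sq_nonneg a]
    rw [mul_one, mul_one, Real.exp_neg, inv_le_iff_one_le_mul₀ (Real.exp_pos _)]
    exact h2.trans (by gcongr; linarith)
  · simp

variable [DecidableEq α]

lemma one_sub_sum_le_prod_one_sub (A : Finset α) (f : α → ℝ) (h0 : ∀ s ∈ A, 0 ≤ f s)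
    (h1 : ∀ s ∈ A, f s ≤ 1) : 1 - ∑ s ∈ A, f s ≤ ∏ s ∈ A, (1 - f s) := by
  induction A using Finset.induction_on with
  | empty => simp
  | insert a A ha ih =>
    rw [sum_insert ha, prod_insert ha]
    have h2 := ih (fun s hs => h0 s (mem_insert_of_mem hs)) fun s hs => h1 s (mem_insert_of_mem hs)
    have h3 : ∏ s ∈ A, (1 - f s) ≤ 1 := prod_le_one
      (fun s hs => by linarith [h1 s (mem_insert_of_mem hs)])
      (fun s hs => by linarith [h0 s (mem_insert_of_mem hs)])
    have := mul_le_mul_of_nonneg_left h3 (h0 a (mem_insert_self a A))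
    linarith

/-- A form of Janson's inequality: the generating function of the number of surviving triples
is at most what independence would give, up to a second order correction. -/
lemma bernExpect_prod_one_sub_kept_le (hp : 0 ≤ p) (hp1 : p ≤ 1)
    (hcard : ∀ s ∈ A, #(E s) = 3)
    (hpair : ∀ s ∈ A, ∀ s' ∈ A, s ≠ s' → #(E s ∩ E s') ≤ 1)
    (hdeg : ∀ e, p ^ 2 * #{s ∈ A | e ∈ E s} ≤ 1) {a : ℝ} (ha : 0 ≤ a) (ha3 : a ≤ 1 / 3) :
    bernExpect p (fun ω => ∏ s ∈ A, (1 - a * kept (E s) ω)) ≤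
      (1 - a * p ^ 3 * (1 - 3 * a)) ^ #A := by
  induction A using Finset.induction_on with
  | empty => simp [bernExpect_one]
  | insert m A hm ih =>
    have hcardA : ∀ s ∈ A, #(E s) = 3 := fun s hs => hcard s (mem_insert_of_mem hs)
    have hfac0 : ∀ s ω, 0 ≤ 1 - a * kept (E s) ω := fun s ω => by
      nlinarith [kept_nonneg (E s) ω, kept_le_one (E s) ω]
    have hfac1 : ∀ s ω, 1 - a * kept (E s) ω ≤ 1 := fun s ω => by
      nlinarith [kept_nonneg (E s) ω]
    have hdegA : ∀ e, p ^ 2 * #{s ∈ A | e ∈ E s} ≤ 1 := fun e => by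
      refine le_trans ?_ (hdeg e)
      gcongr
      exact subset_insert m A
    have ih' := ih hcardA
      (fun s hs s' hs' => hpair s (mem_insert_of_mem hs) s' (mem_insert_of_mem hs')) hdegA
    set N := A.filter (fun s => ¬ Disjoint (E s) (E m)) with hN
    set D := A.filter (fun s => Disjoint (E s) (E m)) with hD
    set F : (ι → Bool) → ℝ := fun ω => ∏ s ∈ A, (1 - a * kept (E s) ω) with hF
    set B : (ι → Bool) → ℝ := fun ω => ∏ s ∈ D, (1 - a * kept (E s) ω) with hB
    have hB0 : ∀ ω, 0 ≤ B ω := fun ω => prod_nonneg fun s _ => hfac0 s ω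
    have hFB : ∀ ω, F ω = B ω * ∏ s ∈ N, (1 - a * kept (E s) ω) := fun ω =>
      (prod_filter_mul_prod_filter_not A _ _).symm
    have hF_le_B : ∀ ω, F ω ≤ B ω := fun ω => by
      rw [hFB]
      exact mul_le_of_le_one_right (hB0 ω) (prod_le_one (fun s _ => hfac0 s ω)
        fun s _ => hfac1 s ω)
    have hB_anti : ∀ U ω, B (forceOn U ω) ≤ B ω := fun U ω =>
      prod_le_prod (fun s _ => hfac0 s _) fun s _ => by
        have := mul_le_mul_of_nonneg_left (kept_le_kept_forceOn (E s) U ω) ha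
        linarith
    have hB_inv : ∀ ω, B (forceOn (E m) ω) = B ω := fun ω =>
      prod_congr rfl fun s hs => by
        rw [kept_forceOn, sdiff_eq_self_of_disjoint (mem_filter.1 hs).2]
    have hEB0 : 0 ≤ bernExpect p B := bernExpect_nonneg hp hp1 hB0
    have hNcard : p ^ 2 * #N ≤ 3 := by
      have h1 : #N ≤ ∑ e ∈ E m, #{s ∈ A | e ∈ E s} := by
        refine le_trans (card_le_card ?_) card_biUnion_le
        intro s hs
        obtain ⟨hsA, hs⟩ := mem_filter.1 hs
        obtain ⟨e, he, he'⟩ := not_disjoint_iff.1 hs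
        exact mem_biUnion.2 ⟨e, he', mem_filter.2 ⟨hsA, he⟩⟩
      calc p ^ 2 * (#N : ℝ) ≤ p ^ 2 * ∑ e ∈ E m, (#{s ∈ A | e ∈ E s} : ℝ) := by
            gcongr; exact_mod_cast h1
        _ = ∑ e ∈ E m, p ^ 2 * (#{s ∈ A | e ∈ E s} : ℝ) := by rw [mul_sum]
        _ ≤ ∑ e ∈ E m, (1 : ℝ) := sum_le_sum fun e _ => hdegA e
        _ = 3 := by simp [hcard m (mem_insert_self m A)]
    have hcross : ∀ s ∈ N, bernExpect p (fun ω => kept (E m ∪ E s) ω * B ω) ≤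
        p ^ 5 * bernExpect p B := by
      intro s hs
      rw [bernExpect_kept_mul]
      have hsA := (mem_filter.1 hs).1
      have h1 := hpair m (mem_insert_self m A) s (mem_insert_of_mem hsA)
        (fun h => hm (h ▸ hsA))
      have h2 := card_union_add_card_inter (E m) (E s)
      have h3 := hcard m (mem_insert_self m A)
      have h4 := hcardA s hsA
      refine mul_le_mul (pow_le_pow_of_le_one hp hp1 (by omega))
        (bernExpect_mono hp hp1 fun ω => hB_anti _ ω) ?_ (by positivity)
      exact bernExpect_nonneg hp hp1 fun ω => hB0 _
    have hmain : p ^ 3 * (1 - 3 * a) * bernExpect p B ≤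
        bernExpect p (fun ω => kept (E m) ω * F ω) := by
      have h1 : bernExpect p (fun ω => kept (E m) ω * B ω -
          a * ∑ s ∈ N, kept (E m ∪ E s) ω * B ω) ≤
          bernExpect p (fun ω => kept (E m) ω * F ω) := by
        refine bernExpect_mono hp hp1 fun ω => ?_
        have h2 := one_sub_sum_le_prod_one_sub N (fun s => a * kept (E s) ω)
          (fun s _ => mul_nonneg ha (kept_nonneg _ _))
          (fun s _ => by linarith [hfac0 s ω])
        have h3 := mul_le_mul_of_nonneg_left h2
          (mul_nonneg (kept_nonneg (E m) ω) (hB0 ω))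
        rw [hFB]
        refine le_trans (le_of_eq ?_) (h3.trans (le_of_eq (by ring)))
        simp only [← kept_mul_kept, mul_sub, mul_one, mul_sum]
        congr 1
        exact sum_congr rfl fun s _ => by ring
      refine le_trans ?_ h1
      rw [bernExpect_sub, bernExpect_const_mul, bernExpect_sum, bernExpect_kept_mul]
      simp only [hB_inv]
      rw [hcard m (mem_insert_self m A)]
      have h4 : ∑ s ∈ N, bernExpect p (fun ω => kept (E m ∪ E s) ω * B ω) ≤
          3 * p ^ 3 * bernExpect p B := by
        refine (sum_le_sum hcross).trans ?_
        rw [sum_const, nsmul_eq_mul]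
        calc (#N : ℝ) * (p ^ 5 * bernExpect p B)
            = (p ^ 2 * #N) * (p ^ 3 * bernExpect p B) := by ring
          _ ≤ 3 * (p ^ 3 * bernExpect p B) := by gcongr
          _ = _ := by ring
      have h5 := mul_le_mul_of_nonneg_left h4 ha
      change _ ≤ p ^ 3 * bernExpect p B - _
      linarith
    have hstep : bernExpect p (fun ω => ∏ s ∈ insert m A, (1 - a * kept (E s) ω)) =
        bernExpect p F - a * bernExpect p (fun ω => kept (E m) ω * F ω) := by
      rw [← bernExpect_const_mul, ← bernExpect_sub]
      congr 1
      ext ω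
      rw [prod_insert hm]
      ring
    rw [hstep, card_insert_of_notMem hm, pow_succ']
    have hc0 : 0 ≤ a * (p ^ 3 * (1 - 3 * a)) :=
      mul_nonneg ha (mul_nonneg (by positivity) (by linarith))
    have hc1 : a * (p ^ 3 * (1 - 3 * a)) ≤ 1 := by
      have h1 : p ^ 3 * (1 - 3 * a) ≤ 1 :=
        mul_le_one₀ (pow_le_one₀ hp hp1) (by linarith) (by linarith)
      calc a * (p ^ 3 * (1 - 3 * a)) ≤ a * 1 := by gcongr
        _ ≤ 1 := by linarith
    have h6 := mul_le_mul_of_nonneg_left hmain ha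
    have h7 := mul_le_mul_of_nonneg_left (bernExpect_mono hp hp1 hF_le_B) hc0
    have h8 := mul_le_mul_of_nonneg_left ih' (show 0 ≤ 1 - a * p ^ 3 * (1 - 3 * a) by linarith)
    linarith

/-- Two-sided tail bound for the number of surviving triples of a linear family: the upper tail
comes from the `k`-th moment, the lower tail from the generating function. -/
lemma bernProb_abs_sum_kept_sub_le (hp : 0 ≤ p) (hp1 : p ≤ 1) (hcard : ∀ s ∈ A, #(E s) = 3)
    (hpair : ∀ s ∈ A, ∀ s' ∈ A, s ≠ s' → #(E s ∩ E s') ≤ 1)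
    (hdeg : ∀ e, p ^ 2 * #{s ∈ A | e ∈ E s} ≤ 1) {ε : ℝ} (hε : 0 < ε) (hε1 : ε ≤ 1)
    {μ : ℝ} (hμ : p ^ 3 * #A = μ) (hμ0 : 0 < μ) (k : ℕ)
    (hk : 3 * (k : ℝ) + (3 * k) ^ 2 ≤ ε / 2 * μ) :
    bernProb p (fun ω => ε * μ ≤ |∑ s ∈ A, kept (E s) ω - μ|) ≤
      ((1 + ε / 2) / (1 + ε)) ^ k + Real.exp (-(ε ^ 2 * μ / 20)) := by
  set T : (ι → Bool) → ℝ := fun ω => ∑ s ∈ A, kept (E s) ω with hT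
  have hT0 : ∀ ω, 0 ≤ T ω := fun ω => sum_nonneg fun s _ => kept_nonneg _ _
  set a := ε / 10 with ha
  set b := a + 2 * a ^ 2 with hb
  have ha0 : 0 ≤ a := by positivity
  have ha3 : a ≤ 1 / 3 := by linarith
  have hb0 : 0 ≤ b := by positivity
  set P : (ι → Bool) → ℝ := fun ω => ∏ s ∈ A, (1 - a * kept (E s) ω) with hP
  have hexpP : ∀ ω, Real.exp (-(b * T ω)) ≤ P ω := exp_neg_mul_sum_kept_le ha3
  have hM : 0 < (1 + ε) * μ := by positivity
  have hupper : bernExpect p (fun ω => T ω ^ k) ≤ ((1 + ε / 2) * μ) ^ k := by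
    have h1 := bernExpect_pow_sum_kept_le hp hp1 hcard hpair hdeg (3 * k) k ∅ (by simp)
    have h2 : ∀ ω : ι → Bool, forceOn ∅ ω = ω := fun ω => by ext; simp [forceOn]
    simp only [h2] at h1
    refine h1.trans ?_
    rw [hμ]
    push_cast
    exact pow_le_pow_left₀ (by positivity) (by linarith) k
  have hlower : bernExpect p P ≤ Real.exp (-(a * (1 - 3 * a) * μ)) := by
    refine (bernExpect_prod_one_sub_kept_le hp hp1 hcard hpair hdeg ha0 ha3).trans ?_
    have h1 : 0 ≤ 1 - a * p ^ 3 * (1 - 3 * a) := by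
      have h2 : p ^ 3 * (1 - 3 * a) ≤ 1 :=
        mul_le_one₀ (pow_le_one₀ hp hp1) (by linarith) (by linarith)
      nlinarith
    have h2 : 1 - a * p ^ 3 * (1 - 3 * a) ≤ Real.exp (-(a * p ^ 3 * (1 - 3 * a))) := by
      have := Real.add_one_le_exp (-(a * p ^ 3 * (1 - 3 * a)))
      linarith
    refine (pow_le_pow_left₀ h1 h2 _).trans (le_of_eq ?_)
    rw [← Real.exp_nat_mul, ← hμ]
    congr 1
    ring
  have hprob : bernProb p (fun ω => ε * μ ≤ |T ω - μ|) ≤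
      bernExpect p (fun ω => (((1 + ε) * μ) ^ k)⁻¹ * T ω ^ k +
        Real.exp (b * ((1 - ε) * μ)) * P ω) := by
    have hP0 : ∀ ω, 0 ≤ Real.exp (b * ((1 - ε) * μ)) * P ω := fun ω =>
      mul_nonneg (Real.exp_pos _).le ((Real.exp_pos _).le.trans (hexpP ω))
    have hQ0 : ∀ ω, 0 ≤ (((1 + ε) * μ) ^ k)⁻¹ * T ω ^ k := fun ω =>
      mul_nonneg (by positivity) (pow_nonneg (hT0 ω) k)
    refine bernProb_le_bernExpect hp hp1 (fun ω => add_nonneg (hQ0 ω) (hP0 ω)) fun ω hω => ?_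
    rcases le_abs.1 hω with h | h
    · refine le_add_of_le_of_nonneg ?_ (hP0 ω)
      rw [inv_mul_eq_div, one_le_div (by positivity)]
      exact pow_le_pow_left₀ hM.le (by linarith) k
    · refine le_add_of_nonneg_of_le (hQ0 ω) ?_
      refine le_trans ?_ (mul_le_mul_of_nonneg_left (hexpP ω) (Real.exp_pos _).le)
      rw [← Real.exp_add, Real.one_le_exp_iff]
      have := mul_le_mul_of_nonneg_left (show T ω ≤ (1 - ε) * μ by linarith) hb0
      linarith
  refine hprob.trans ?_
  rw [bernExpect_add, bernExpect_const_mul, bernExpect_const_mul]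
  refine add_le_add ?_ ?_
  · refine (mul_le_mul_of_nonneg_left hupper (by positivity)).trans (le_of_eq ?_)
    rw [inv_mul_eq_div, ← div_pow, mul_div_mul_right _ _ hμ0.ne']
  · refine (mul_le_mul_of_nonneg_left hlower (Real.exp_pos _).le).trans ?_
    rw [← Real.exp_add, Real.exp_le_exp]
    have h1 : b * (1 - ε) - a * (1 - 3 * a) ≤ -(ε ^ 2 / 20) := by
      have : 0 ≤ ε ^ 3 := by positivity
      rw [hb, ha]
      nlinarith
    have := mul_le_mul_of_nonneg_right h1 hμ0.le
    linarith

end LinearTriples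

section TriangleEdges

variable {V : Type*} [Fintype V] [DecidableEq V] (G : SimpleGraph V) [DecidableRel G.Adj]

/-- The edges of `G` with both endpoints in `s`. -/
def edgesWithin (s : Finset V) : Finset {e : Sym2 V // e ∈ G.edgeFinset} :=
  univ.filter fun e => (e : Sym2 V) ∈ s.sym2

variable {G}

lemma mem_edgesWithin {s : Finset V} {e : {e : Sym2 V // e ∈ G.edgeFinset}} :
    e ∈ edgesWithin G s ↔ (e : Sym2 V) ∈ s.sym2 := by
  simp [edgesWithin]

lemma card_edgesWithin {s : Finset V} (hs : s ∈ G.cliqueFinset 3) :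
    #(edgesWithin G s) = 3 := by
  rw [SimpleGraph.mem_cliqueFinset_iff, SimpleGraph.is3Clique_iff] at hs
  obtain ⟨a, b, c, hab, hac, hbc, rfl⟩ := hs
  have h : (edgesWithin G {a, b, c}).map (Function.Embedding.subtype _) =
      {s(a, b), s(a, c), s(b, c)} := by
    ext e
    induction e using Sym2.ind with
    | _ x y =>
      simp only [mem_map, mem_edgesWithin, Function.Embedding.subtype_apply, Subtype.exists,
        exists_and_right, exists_eq_right, exists_prop, SimpleGraph.mem_edgeFinset,
        SimpleGraph.mem_edgeSet, mk_mem_sym2_iff, mem_insert, mem_singleton, Sym2.eq_iff]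
      constructor
      · rintro ⟨hxy, hx, hy⟩
        have := hxy.ne
        grind
      · rintro ((⟨rfl, rfl⟩ | ⟨rfl, rfl⟩) | (⟨rfl, rfl⟩ | ⟨rfl, rfl⟩) |
          (⟨rfl, rfl⟩ | ⟨rfl, rfl⟩)) <;> simp [*, hab.symm, hac.symm, hbc.symm]
  rw [← card_map, h, card_eq_three]
  have := hab.ne
  have := hac.ne
  have := hbc.ne
  refine ⟨_, _, _, ?_, ?_, ?_, rfl⟩ <;> simp only [ne_eq, Sym2.eq_iff] <;> grind

lemma card_edgesWithin_inter_le_one {s s' : Finset V} (hs : s ∈ G.cliqueFinset 3)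
    (hs' : s' ∈ G.cliqueFinset 3) (hne : s ≠ s') :
    #(edgesWithin G s ∩ edgesWithin G s') ≤ 1 := by
  have h3 := (SimpleGraph.mem_cliqueFinset_iff.1 hs).card_eq
  have h3' := (SimpleGraph.mem_cliqueFinset_iff.1 hs').card_eq
  have hinter : #(s ∩ s') ≤ 2 := by
    by_contra! h
    have h1 : s ∩ s' = s := eq_of_subset_of_card_le inter_subset_left (by omega)
    have h2 : s ∩ s' = s' := eq_of_subset_of_card_le inter_subset_right (by omega)
    exact hne (h1.symm.trans h2)
  have hverts : ∀ e ∈ edgesWithin G s ∩ edgesWithin G s',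
      (e : Sym2 V).toFinset = s ∩ s' := by
    intro e he
    rw [mem_inter, mem_edgesWithin, mem_edgesWithin, mem_sym2_iff, mem_sym2_iff] at he
    refine eq_of_subset_of_card_le (fun v hv => ?_) ?_
    · rw [Sym2.mem_toFinset] at hv
      exact mem_inter.2 ⟨he.1 v hv, he.2 v hv⟩
    · rwa [Sym2.card_toFinset_of_not_isDiag _
        (G.not_isDiag_of_mem_edgeSet (SimpleGraph.mem_edgeFinset.1 e.2))]
  refine card_le_one.2 fun e he f hf => Subtype.ext (Sym2.ext fun v => ?_)
  rw [← Sym2.mem_toFinset, ← Sym2.mem_toFinset, hverts e he, hverts f hf]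

lemma card_filter_mem_edgesWithin_le (e : {e : Sym2 V // e ∈ G.edgeFinset}) :
    #{s ∈ G.cliqueFinset 3 | e ∈ edgesWithin G s} ≤ maxTriEdge G := by
  simp only [mem_edgesWithin]
  exact le_sup (f := triEdgeCount G) e.2

end TriangleEdges

lemma bernProb_mono {ι : Type*} [Fintype ι] [DecidableEq ι] {p : ℝ} (hp : 0 ≤ p) (hp1 : p ≤ 1)
    {A B : (ι → Bool) → Prop} (h : ∀ ω, A ω → B ω) : bernProb p A ≤ bernProb p B := by
  refine sum_le_sum fun ω _ => ?_
  have hw := bernWeight_nonneg hp hp1 ω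
  split_ifs with h1 h2 h2
  · rfl
  · exact absurd (h ω h1) h2
  · exact hw
  · rfl

lemma bernProb_triCount_le {V : Type*} [Fintype V] [DecidableEq V] (G : SimpleGraph V)
    [DecidableRel G.Adj] {p : ℝ} (hp : 0 ≤ p) (hp1 : p ≤ 1)
    (hΔ : p ^ 2 * (maxTriEdge G : ℝ) ≤ 1) {ε δ : ℝ} (hδ : 0 < δ) (hδ1 : δ ≤ 1) (hδε : δ ≤ ε)
    {μ : ℝ} (hμ : p ^ 3 * #(G.cliqueFinset 3) = μ) (hμ0 : 0 < μ) (k : ℕ)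
    (hk : 3 * (k : ℝ) + (3 * k) ^ 2 ≤ δ / 2 * μ) :
    bernProb p (fun ω =>
        ε * bernExpect p (triCount G) ≤ |triCount G ω - bernExpect p (triCount G)|) ≤
      ((1 + δ / 2) / (1 + δ)) ^ k + Real.exp (-(δ ^ 2 * μ / 20)) := by
  have hcard : ∀ s ∈ G.cliqueFinset 3, #(edgesWithin G s) = 3 := fun s hs => card_edgesWithin hs
  have hT : ∀ ω, triCount G ω = ∑ s ∈ G.cliqueFinset 3, kept (edgesWithin G s) ω := fun ω => rfl
  have hET : bernExpect p (triCount G) = μ := (bernExpect_sum_kept hcard).trans hμ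
  rw [hET]
  refine le_trans (bernProb_mono hp hp1 fun ω hω => ?_)
    (bernProb_abs_sum_kept_sub_le hp hp1 hcard
      (fun s hs s' hs' => card_edgesWithin_inter_le_one hs hs') (fun e => ?_) hδ hδ1 hμ hμ0 k hk)
  · rw [← hT]
    exact le_trans (by gcongr) hω
  · refine le_trans ?_ hΔ
    gcongr
    exact card_filter_mem_edgesWithin_le e

universe u

/-- Theorem 2, Case `p²Δ < 1`.  For any constants `γ, K, ε > 0`
there is an `n₀` such that for every finite simple graph `G` on `n ≥ n₀` vertices,
with `t` triangles and `Δ` the maximal number of triangles sharing a common edge,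
and every `p ∈ (0,1]` with `p²Δ < 1` and `p³·t ≥ (log n)^(6+γ)`, the number `T`
of surviving triangles after keeping each edge independently with probability `p`
satisfies `P(|T - E[T]| ≥ ε·E[T]) ≤ n^(-K)`. -/
theorem approx_triangle_counting_case_small
    (γ : ℝ) (hγ : 0 < γ) (K : ℝ) (hK : 0 < K) (ε : ℝ) (hε : 0 < ε) :
    ∃ n₀ : ℕ, ∀ (V : Type u) [Fintype V] [DecidableEq V]
      (G : SimpleGraph V) [DecidableRel G.Adj] (p : ℝ),
      0 < p → p ≤ 1 →
      n₀ ≤ Fintype.card V →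
      p ^ 2 * (maxTriEdge G : ℝ) < 1 →
      Real.log (Fintype.card V) ^ ((6 : ℝ) + γ) ≤
        p ^ 3 * ((G.cliqueFinset 3).card : ℝ) →
      bernProb p (fun ω =>
          ε * bernExpect p (triCount G) ≤ |triCount G ω - bernExpect p (triCount G)|)
        ≤ (Fintype.card V : ℝ) ^ (-K) := by
  obtain ⟨δ, hδ, hδ1, hδε⟩ : ∃ δ : ℝ, 0 < δ ∧ δ ≤ 1 ∧ δ ≤ ε :=
    ⟨min ε 1, lt_min hε one_pos, min_le_right _ _, min_le_left _ _⟩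
  obtain ⟨c, hc, hq⟩ : ∃ c : ℝ, 0 < c ∧ (1 + δ / 2) / (1 + δ) = Real.exp (-c) := by
    have hq0 : 0 < (1 + δ / 2) / (1 + δ) := by positivity
    have hq1 : (1 + δ / 2) / (1 + δ) < 1 := by
      rw [div_lt_one (by positivity)]
      linarith
    exact ⟨-Real.log ((1 + δ / 2) / (1 + δ)), neg_pos.2 (Real.log_neg hq0 hq1),
      by rw [neg_neg, Real.exp_log hq0]⟩
  set d := (K + 1) / c + 1 with hd
  have hd1 : 1 ≤ d := le_add_of_nonneg_left (by positivity)
  set C := 1 + 24 * d ^ 2 / δ + 20 * (K + 1) / δ ^ 2 with hC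
  refine ⟨⌈Real.exp C⌉₊, fun V _ _ G _ p hp hp1 hn hΔ ht => ?_⟩
  set n : ℝ := (Fintype.card V : ℝ) with hn'
  set L := Real.log n with hL
  have hexp : Real.exp C ≤ n := Nat.ceil_le.1 hn
  have hn0 : 0 < n := (Real.exp_pos _).trans_le hexp
  have hCL : C ≤ L := (Real.le_log_iff_exp_le hn0).2 hexp
  have h24 : 0 ≤ 24 * d ^ 2 / δ := by positivity
  have h20 : 0 ≤ 20 * (K + 1) / δ ^ 2 := by positivity
  have hL1 : 1 ≤ L := by linarith
  have hn2 : 2 ≤ n := by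
    have := Real.add_one_le_exp C
    linarith
  obtain ⟨μ, hμ⟩ : ∃ μ : ℝ, p ^ 3 * #(G.cliqueFinset 3) = μ := ⟨_, rfl⟩
  have hLμ : L ^ 3 ≤ μ := by
    rw [← hμ, ← Real.rpow_natCast]
    exact (Real.rpow_le_rpow_of_exponent_le hL1 (by push_cast; linarith)).trans ht
  have hL0 : 0 < L := by linarith
  have hμ0 : 0 < μ := (pow_pos hL0 3).trans_le hLμ
  set k := ⌈(K + 1) / c * L⌉₊ with hk
  have hkL : (K + 1) / c * L ≤ k := Nat.le_ceil _
  have hkd : (k : ℝ) ≤ d * L := by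
    have := (Nat.ceil_lt_add_one (show 0 ≤ (K + 1) / c * L by positivity)).le
    rw [hd, add_mul, one_mul]
    linarith
  have hkμ : 3 * (k : ℝ) + (3 * k) ^ 2 ≤ δ / 2 * μ := by
    have h1 : 1 ≤ d * L := one_le_mul_of_one_le_of_one_le hd1 hL1
    have h2 : 24 * d ^ 2 ≤ δ * L := by
      rw [mul_comm δ, ← div_le_iff₀ hδ]
      linarith
    calc 3 * (k : ℝ) + (3 * k) ^ 2 ≤ 3 * (d * L) + (3 * (d * L)) ^ 2 := by gcongr
      _ ≤ 12 * (d * L) ^ 2 := by nlinarith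
      _ = 24 * d ^ 2 * L ^ 2 / 2 := by ring
      _ ≤ δ * L * L ^ 2 / 2 := by gcongr
      _ = δ / 2 * L ^ 3 := by ring
      _ ≤ δ / 2 * μ := by gcongr
  refine (bernProb_triCount_le G hp.le hp1 hΔ.le hδ hδ1 hδε hμ hμ0 k hkμ).trans ?_
  have hupper : ((1 + δ / 2) / (1 + δ)) ^ k ≤ Real.exp (-((K + 1) * L)) := by
    rw [hq, ← Real.exp_nat_mul, Real.exp_le_exp]
    rw [div_mul_eq_mul_div, div_le_iff₀ hc] at hkL
    linarith
  have hlower : Real.exp (-(δ ^ 2 * μ / 20)) ≤ Real.exp (-((K + 1) * L)) := by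
    rw [Real.exp_le_exp, neg_le_neg_iff]
    have h1 : 20 * (K + 1) ≤ δ ^ 2 * L := by
      rw [mul_comm (δ ^ 2), ← div_le_iff₀ (by positivity)]
      linarith
    have h2 : L ^ 2 ≤ μ := (pow_le_pow_right₀ hL1 (by norm_num)).trans hLμ
    have h3 := mul_le_mul_of_nonneg_right h1 hL0.le
    have h4 := mul_le_mul_of_nonneg_left h2 (sq_nonneg δ)
    linarith
  have hpow : n ^ (-K) = n * Real.exp (-((K + 1) * L)) := by
    rw [Real.rpow_def_of_pos hn0]
    nth_rewrite 2 [← Real.exp_log hn0]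
    rw [← Real.exp_add]
    congr 1
    ring
  rw [hpow]
  have := mul_le_mul_of_nonneg_right hn2 (Real.exp_pos (-((K + 1) * L))).le
  linarith
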